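/- arXiv:1705.05815 — 4 statements merged into one kernel-verified Lean document; each statement's English description precedes it below -/
import Mathlib

section
/- Let n ≥ 1 and let Ω ⊂ ℂⁿ be a smooth, bounded, pseudoconvex domain satisfying Catlin's Property (P). Then the Diederich–Fornaess index of Ω equals 1; that is, for every η with 0 < η < 1 there exists a smooth defining function ρ_η for Ω such that the function −(−ρ_η)^η is plurisubharmonic on Ω. -/
open Set

/-- The real Hessian quantity `Hu(z)(v) = D²u(z)(v,v) + D²u(z)(iv,iv)`, equal to four times
the complex Hessian of `u` at `z` applied to `v`. -/
noncomputable def reHess {n : ℕ} (u : EuclideanSpace ℂ (Fin n) → ℝ)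
    (z v : EuclideanSpace ℂ (Fin n)) : ℝ :=
  fderiv ℝ (fderiv ℝ u) z v v + fderiv ℝ (fderiv ℝ u) z (Complex.I • v) (Complex.I • v)

/-- `ρ` is a smooth defining function for the bounded open set `Ω`. -/
def IsDefiningFunction {n : ℕ} (Ω : Set (EuclideanSpace ℂ (Fin n)))
    (ρ : EuclideanSpace ℂ (Fin n) → ℝ) : Prop :=
  ContDiff ℝ (⊤ : ℕ∞) ρ ∧ Ω = {z | ρ z < 0} ∧ frontier Ω = {z | ρ z = 0} ∧
    ∀ z ∈ frontier Ω, fderiv ℝ ρ z ≠ 0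

open Filter Topology

section Hessian

variable {n : ℕ}

local notation "E" => EuclideanSpace ℂ (Fin n)

lemma norm_I_smul (v : E) : ‖Complex.I • v‖ = ‖v‖ := by
  rw [norm_smul, Complex.norm_I, one_mul]

/-- The chain rule for the complex Hessian. -/
lemma reHess_comp {g g' : ℝ → ℝ} {g'' : ℝ} {u : E → ℝ} {z : E} (hu : ContDiffAt ℝ 2 u z)
    (hg : ∀ᶠ t in 𝓝 (u z), HasDerivAt g (g' t) t) (hg' : HasDerivAt g' g'' (u z)) (v : E) :
    reHess (fun w => g (u w)) z v = g' (u z) * reHess u z v +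
      g'' * ((fderiv ℝ u z v) ^ 2 + (fderiv ℝ u z (Complex.I • v)) ^ 2) := by
  have hu1 : ∀ᶠ w in 𝓝 z, DifferentiableAt ℝ u w :=
    (hu.eventually (by simp)).mono fun w hw => hw.differentiableAt (by norm_num)
  have h1 : fderiv ℝ (fun w => g (u w)) =ᶠ[𝓝 z] fun w => g' (u w) • fderiv ℝ u w := by
    filter_upwards [hu1, hu.continuousAt.eventually hg] with w hw hgw
    exact (hgw.comp_hasFDerivAt w hw.hasFDerivAt).fderiv
  have h2 : HasFDerivAt (fderiv ℝ u) (fderiv ℝ (fderiv ℝ u) z) z :=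
    ((hu.fderiv_right (m := 1) (by norm_num)).differentiableAt (by norm_num)).hasFDerivAt
  have h3 : HasFDerivAt (fun w => g' (u w)) (g'' • fderiv ℝ u z) z :=
    hg'.comp_hasFDerivAt z hu1.self_of_nhds.hasFDerivAt
  have h4 : fderiv ℝ (fderiv ℝ (fun w => g (u w))) z = _ :=
    h1.fderiv_eq.trans (h3.smul h2).fderiv
  simp only [reHess, h4]
  simp
  ring

lemma reHess_add_const_mul {u w : E → ℝ} {z : E} (hu : ContDiffAt ℝ 2 u z)
    (hw : ContDiffAt ℝ 2 w z) (c : ℝ) (v : E) :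
    reHess (fun x => u x + c * w x) z v = reHess u z v + c * reHess w z v := by
  have key : ∀ {f : E → ℝ}, ContDiffAt ℝ 2 f z → (∀ᶠ x in 𝓝 z, DifferentiableAt ℝ f x) ∧
      DifferentiableAt ℝ (fderiv ℝ f) z := fun hf =>
    ⟨(hf.eventually (by simp)).mono fun x hx => hx.differentiableAt (by norm_num),
      (hf.fderiv_right (m := 1) (by norm_num)).differentiableAt (by norm_num)⟩
  have h1 : fderiv ℝ (fun x => u x + c * w x) =ᶠ[𝓝 z]
      fun x => fderiv ℝ u x + c • fderiv ℝ w x := by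
    filter_upwards [(key hu).1, (key hw).1] with x hx hx'
    exact (hx.hasFDerivAt.add (hx'.hasFDerivAt.const_mul c)).fderiv
  have h4 : fderiv ℝ (fderiv ℝ (fun x => u x + c * w x)) z = _ :=
    h1.fderiv_eq.trans
      ((key hu).2.hasFDerivAt.add ((key hw).2.hasFDerivAt.const_smul c)).fderiv
  simp only [reHess, h4]
  simp
  ring

lemma abs_bilin_sub_le (B : E →L[ℝ] E →L[ℝ] ℝ) (v t : E) :
    |B v v - B t t| ≤ ‖B‖ * (‖v‖ + ‖t‖) * ‖v - t‖ := by
  have h : B v v - B t t = B v (v - t) + B (v - t) t := by simp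
  have h1 := B.le_opNorm₂ v (v - t)
  have h2 := B.le_opNorm₂ (v - t) t
  rw [Real.norm_eq_abs] at h1 h2
  rw [h]
  refine (abs_add_le _ _).trans ?_
  nlinarith

/-- The complex Hessian depends continuously on the second derivative and on the vector. -/
lemma reHess_sub_le (u : E → ℝ) (z v t : E) :
    reHess u z t - reHess u z v ≤
      2 * (‖fderiv ℝ (fderiv ℝ u) z‖ * (‖v‖ + ‖t‖) * ‖v - t‖) := by
  have h1 := abs_bilin_sub_le (fderiv ℝ (fderiv ℝ u) z) v t
  have h2 := abs_bilin_sub_le (fderiv ℝ (fderiv ℝ u) z) (Complex.I • v) (Complex.I • t)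
  rw [← smul_sub, norm_I_smul, norm_I_smul, norm_I_smul] at h2
  have h1 := (abs_le.1 h1).1
  have h2 := (abs_le.1 h2).1
  simp only [reHess]
  linarith

lemma abs_reHess_sub_le (u : E → ℝ) (z q v : E) :
    |reHess u z v - reHess u q v| ≤
      2 * (‖fderiv ℝ (fderiv ℝ u) z - fderiv ℝ (fderiv ℝ u) q‖ * ‖v‖ ^ 2) := by
  set B := fderiv ℝ (fderiv ℝ u) z - fderiv ℝ (fderiv ℝ u) q with hB
  have h1 := B.le_opNorm₂ v v
  have h2 := B.le_opNorm₂ (Complex.I • v) (Complex.I • v)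
  rw [norm_I_smul] at h2
  have h : reHess u z v - reHess u q v = B v v + B (Complex.I • v) (Complex.I • v) := by
    simp only [reHess, hB, sub_apply]
    ring
  rw [h]
  refine (abs_add_le _ _).trans ?_
  rw [Real.norm_eq_abs] at h1 h2
  linarith

/-- A strict upper bound for the complex Hessian at a point persists nearby. -/
lemma eventually_reHess_le {u : E → ℝ} (hu : ContDiff ℝ 2 u) {p : E} {M : ℝ} (hM : 0 < M)
    (h : ∀ v, reHess u p v ≤ -(4 * M * ‖v‖ ^ 2)) :
    ∀ᶠ z in 𝓝 p, ∀ v, reHess u z v ≤ -(2 * M * ‖v‖ ^ 2) := by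
  have hc : Continuous (fderiv ℝ (fderiv ℝ u)) :=
    (hu.fderiv_right (m := 1) (by norm_num)).continuous_fderiv (by norm_num)
  have hnear : ∀ᶠ z in 𝓝 p, ‖fderiv ℝ (fderiv ℝ u) z - fderiv ℝ (fderiv ℝ u) p‖ < M := by
    have key : ∀ {F : Type} [NormedAddCommGroup F] {f : E → F}, Continuous f →
        ∀ᶠ z in 𝓝 p, ‖f z - f p‖ < M := fun hf =>
      (hf.sub continuous_const).norm.continuousAt.eventually_lt continuousAt_const (by simpa)
    exact key (F := E →L[ℝ] E →L[ℝ] ℝ) hc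
  filter_upwards [hnear] with z hz v
  have h1 := (abs_le.1 (abs_reHess_sub_le u z p v)).2
  have h2 := h v
  have h3 := mul_le_mul_of_nonneg_right hz.le (sq_nonneg ‖v‖)
  linarith

/-- Splitting off a complex tangential component. -/
lemma exists_complex_tangential {l : E →L[ℝ] ℝ} {w : E} (hw : 1 / 2 ≤ l w) (v : E) :
    ∃ t : E, l t = 0 ∧ l (Complex.I • t) = 0 ∧
      ‖v - t‖ ≤ 4 * (|l v| + |l (Complex.I • v)|) * ‖w‖ := by
  set x := l w
  set y := l (Complex.I • w) with hy
  set a := l v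
  set b := l (Complex.I • v)
  have hx : 0 < x := by linarith
  have hd : 0 < x ^ 2 + y ^ 2 := by positivity
  set α := (x * a + y * b) / (x ^ 2 + y ^ 2)
  set β := (y * a - x * b) / (x ^ 2 + y ^ 2)
  have hII : Complex.I • (Complex.I • w) = -w := by
    rw [smul_smul, Complex.I_mul_I, neg_one_smul]
  have hx2 : |x| ≤ 2 * (x ^ 2 + y ^ 2) := by
    rw [abs_of_pos hx]; nlinarith [sq_nonneg y]
  have hy2 : |y| ≤ 2 * (x ^ 2 + y ^ 2) := by
    rw [abs_le]; constructor <;> nlinarith [sq_nonneg (y - 1/2), sq_nonneg (y + 1/2)]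
  have hα : |α| ≤ 2 * (|a| + |b|) := by
    rw [abs_div, abs_of_pos hd, div_le_iff₀ hd]
    refine (abs_add_le _ _).trans ?_
    rw [abs_mul, abs_mul]
    nlinarith [abs_nonneg a, abs_nonneg b]
  have hβ : |β| ≤ 2 * (|a| + |b|) := by
    rw [abs_div, abs_of_pos hd, div_le_iff₀ hd]
    refine (abs_sub _ _).trans ?_
    rw [abs_mul, abs_mul]
    nlinarith [abs_nonneg a, abs_nonneg b]
  refine ⟨v - (α • w + β • (Complex.I • w)), ?_, ?_, ?_⟩
  · have : l (v - (α • w + β • (Complex.I • w))) = a - (α * x + β * y) := by simp [a, x, y]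
    rw [this]
    simp only [α, β]
    field_simp
    ring
  · have : l (Complex.I • (v - (α • w + β • (Complex.I • w)))) = b - (α * y - β * x) := by
      rw [smul_sub, smul_add, smul_comm Complex.I α, smul_comm Complex.I β, hII]
      simp [b, x, y]
      ring
    rw [this]
    simp only [α, β]
    field_simp
    ring
  · rw [sub_sub_cancel]
    refine (norm_add_le _ _).trans ?_
    rw [norm_smul, norm_smul, norm_I_smul, Real.norm_eq_abs, Real.norm_eq_abs]
    nlinarith [norm_nonneg w]

/-- Near a regular zero `p`, the distance to the zero set is controlled by the function. -/
lemma eventually_exists_zero_near {ρ : E → ℝ} (hρ : ContDiff ℝ 1 ρ) {p w : E}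
    (hp : ρ p = 0) (hw : fderiv ℝ ρ p w = 1) {W : Set E} (hW : W ∈ 𝓝 p) :
    ∀ᶠ z in 𝓝 p, ρ z < 0 → ∃ q ∈ W, ρ q = 0 ∧ ‖z - q‖ ≤ 2 * |ρ z| * ‖w‖ := by
  have hw0 : 0 < ‖w‖ := norm_pos_iff.2 (by rintro rfl; simp at hw)
  have hs : HasStrictFDerivAt ρ (fderiv ℝ ρ p) p :=
    hρ.contDiffAt.hasStrictFDerivAt (by norm_num)
  have hlin := hs.isLittleO.def (c := 1 / (2 * ‖w‖)) (by positivity)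
  rw [nhds_prod_eq] at hlin
  obtain ⟨V, hV, hVlin⟩ := eventually_prod_self_iff (r := fun x y =>
    ‖ρ x - ρ y - fderiv ℝ ρ p (x - y)‖ ≤ 1 / (2 * ‖w‖) * ‖x - y‖).1 hlin
  obtain ⟨R, hR, hball⟩ := Metric.mem_nhds_iff.1 (inter_mem hV hW)
  have hsmall : ∀ᶠ z in 𝓝 p, ‖z - p‖ + 2 * |ρ z| * ‖w‖ < R := by
    have hc : Continuous fun z => ‖z - p‖ + 2 * |ρ z| * ‖w‖ := by
      have := hρ.continuous
      fun_prop
    refine hc.continuousAt.eventually_lt continuousAt_const ?_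
    simpa [hp] using hR
  filter_upwards [hsmall] with z hz hneg
  have hmem : ∀ t ∈ Icc (0 : ℝ) (2 * |ρ z|), z + t • w ∈ V ∩ W := by
    intro t ht
    apply hball
    rw [Metric.mem_ball, dist_eq_norm, add_sub_right_comm]
    refine (norm_add_le _ _).trans_lt (lt_of_le_of_lt ?_ hz)
    rw [norm_smul, Real.norm_of_nonneg ht.1]
    gcongr
    exact ht.2
  have hpos : (0 : ℝ) ≤ 2 * |ρ z| := by positivity
  have hend : 0 ≤ ρ (z + (2 * |ρ z|) • w) := by
    have h := hVlin _ (hmem _ (right_mem_Icc.2 hpos)).1 _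
      (by simpa using (hmem _ (left_mem_Icc.2 hpos)).1)
    simp only [add_sub_cancel_left, map_smul, hw, norm_smul, Real.norm_of_nonneg hpos] at h
    have h2 : 1 / (2 * ‖w‖) * (2 * |ρ z| * ‖w‖) = |ρ z| := by field_simp
    rw [h2, Real.norm_eq_abs] at h
    have h3 := (abs_le.1 h).1
    rw [abs_of_neg hneg] at h3 ⊢
    simp only [smul_eq_mul, mul_one] at h3
    linarith
  have hcont : ContinuousOn (fun t : ℝ => ρ (z + t • w)) (Icc 0 (2 * |ρ z|)) := by
    have := hρ.continuous
    fun_prop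
  obtain ⟨t, ht, ht0⟩ := intermediate_value_Icc hpos hcont
    (show (0 : ℝ) ∈ Icc _ _ from ⟨by simpa using hneg.le, hend⟩)
  refine ⟨z + t • w, (hmem t ht).2, ht0, ?_⟩
  rw [sub_add_cancel_left, norm_neg, norm_smul, Real.norm_of_nonneg ht.1]
  gcongr
  exact ht.2

/-- The Levi form of a pseudoconvex domain is bounded below near the boundary, with an error
that vanishes on complex tangential vectors as the boundary is approached. -/
lemma exists_eventually_reHess_ge {ρ : E → ℝ} (hρ : ContDiff ℝ (⊤ : ℕ∞) ρ)
    (hpsc : ∀ q, ρ q = 0 → ∀ v : E, fderiv ℝ ρ q v = 0 → fderiv ℝ ρ q (Complex.I • v) = 0 →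
      0 ≤ reHess ρ q v) {p : E} (hp : ρ p = 0) (hdp : fderiv ℝ ρ p ≠ 0) :
    ∃ C : ℝ, ∀ᶠ z in 𝓝 p, ρ z < 0 → ∀ v : E,
      -(C * (|ρ z| * ‖v‖ ^ 2 + ‖v‖ * (|fderiv ℝ ρ z v| + |fderiv ℝ ρ z (Complex.I • v)|))) ≤
        reHess ρ z v := by
  obtain ⟨w₀, hw₀⟩ : ∃ w, fderiv ℝ ρ p w ≠ 0 := by
    by_contra! h
    exact hdp (ContinuousLinearMap.ext h)
  obtain ⟨w, hw⟩ : ∃ w, fderiv ℝ ρ p w = 1 :=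
    ⟨(fderiv ℝ ρ p w₀)⁻¹ • w₀, by simp [hw₀]⟩
  have hd1 : ContDiff ℝ 2 (fderiv ℝ ρ) :=  (contDiff_infty.1 hρ 3).fderiv_right (by norm_num)
  have hd2 : ContDiff ℝ 1 (fderiv ℝ (fderiv ℝ ρ)) := hd1.fderiv_right (by norm_num)
  obtain ⟨K₁, W₁, hW₁, hK₁⟩ :=
    ((hd1.of_le (by norm_num : (1 : WithTop ℕ∞) ≤ 2)).contDiffAt (x := p)).exists_lipschitzOnWith
  obtain ⟨K₂, W₂, hW₂, hK₂⟩ := (hd2.contDiffAt (x := p)).exists_lipschitzOnWith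
  have bound : ∀ {F : Type} [NormedAddCommGroup F] {f : E → F}, Continuous f →
      ∀ᶠ q in 𝓝 p, ‖f q‖ < ‖f p‖ + 1 := fun hf =>
    hf.norm.continuousAt.eventually_lt continuousAt_const (lt_add_one _)
  have hW₃ := bound hd2.continuous
  have hW₅ := bound hd1.continuous
  set B := ‖fderiv ℝ (fderiv ℝ ρ) p‖ + 1
  set B₁ := ‖fderiv ℝ ρ p‖ + 1
  have hB : 0 ≤ B := by positivity
  have hB₁ : 0 ≤ B₁ := by positivity
  have hW₄ : ∀ᶠ q in 𝓝 p, 1 / 2 < fderiv ℝ ρ q w := by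
    have : Continuous fun q => fderiv ℝ ρ q w := hd1.continuous.clm_apply continuous_const
    exact continuousAt_const.eventually_lt this.continuousAt (by rw [hw]; norm_num)
  have hW := inter_mem (inter_mem hW₁ hW₂) (inter_mem hW₃ (inter_mem hW₄ hW₅))
  set m := 2 * ‖w‖
  set D := 2 + 8 * B₁ * ‖w‖
  set A := 8 * B * D * ‖w‖
  have hA : 0 ≤ A := by positivity
  refine ⟨2 * K₂ * m + A + 2 * A * K₁ * m, ?_⟩
  filter_upwards [hW₁, hW₂, eventually_exists_zero_near
    (hρ.of_le (by exact_mod_cast le_top)) hp hw hW] with z hz₁ hz₂ hz hneg v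
  obtain ⟨q, ⟨⟨hq₁, hq₂⟩, hq₃, hq₄, hq₅⟩, hq0, hzq⟩ := hz hneg
  obtain ⟨t, ht, hIt, hvt⟩ := exists_complex_tangential hq₄.le v
  have hlev := hpsc q hq0 t ht hIt
  have hzq' : ‖z - q‖ ≤ m * |ρ z| := hzq.trans_eq (by ring)
  have hl1 : ‖fderiv ℝ ρ z - fderiv ℝ ρ q‖ ≤ K₁ * (m * |ρ z|) :=
    (hK₁.norm_sub_le hz₁ hq₁).trans (by gcongr)
  have hl2 : ‖fderiv ℝ (fderiv ℝ ρ) z - fderiv ℝ (fderiv ℝ ρ) q‖ ≤ K₂ * (m * |ρ z|) :=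
    (hK₂.norm_sub_le hz₂ hq₂).trans (by gcongr)
  have hdiff : ∀ x : E, ‖x‖ = ‖v‖ →
      |fderiv ℝ ρ q x| ≤ |fderiv ℝ ρ z x| + K₁ * (m * |ρ z|) * ‖v‖ := by
    intro x hx
    have h1 := (fderiv ℝ ρ z - fderiv ℝ ρ q).le_of_opNorm_le hl1 x
    rw [hx, sub_apply, Real.norm_eq_abs, abs_sub_comm] at h1
    linarith [abs_sub_abs_le_abs_sub (fderiv ℝ ρ q x) (fderiv ℝ ρ z x)]
  have hbd : ∀ x : E, ‖x‖ = ‖v‖ → |fderiv ℝ ρ q x| ≤ B₁ * ‖v‖ := fun x hx => by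
    simpa [hx] using (fderiv ℝ ρ q).le_of_opNorm_le (le_of_lt hq₅) x
  have hT := add_le_add (hdiff v rfl) (hdiff _ (norm_I_smul v))
  have hTb := add_le_add (hbd v rfl) (hbd _ (norm_I_smul v))
  set T := |fderiv ℝ ρ z v| + |fderiv ℝ ρ z (Complex.I • v)|
  set S := |fderiv ℝ ρ q v| + |fderiv ℝ ρ q (Complex.I • v)|
  have hS : S ≤ T + 2 * K₁ * m * |ρ z| * ‖v‖ := by
    simp only [T]
    linarith
  have hsum : ‖v‖ + ‖t‖ ≤ D * ‖v‖ := by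
    have h1 : ‖t‖ ≤ ‖v‖ + ‖v - t‖ := by
      simpa using norm_sub_le v (v - t)
    have h2 : 4 * S * ‖w‖ ≤ 4 * (B₁ * ‖v‖ + B₁ * ‖v‖) * ‖w‖ := by gcongr
    simp only [D]
    linarith
  have hHq : -reHess ρ q v ≤ A * ‖v‖ * S := by
    have h1 : ‖fderiv ℝ (fderiv ℝ ρ) q‖ * (‖v‖ + ‖t‖) * ‖v - t‖ ≤
        B * (D * ‖v‖) * (4 * S * ‖w‖) := by
      gcongr
      exact le_of_lt hq₃
    have h2 := reHess_sub_le ρ q v t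
    simp only [A]
    linarith
  have hHz : reHess ρ q v - reHess ρ z v ≤ 2 * (K₂ * (m * |ρ z|) * ‖v‖ ^ 2) := by
    have h1 := (abs_le.1 (abs_reHess_sub_le ρ z q v)).1
    have h2 := mul_le_mul_of_nonneg_right hl2 (sq_nonneg ‖v‖)
    linarith
  have hAS : A * ‖v‖ * S ≤ A * ‖v‖ * (T + 2 * K₁ * m * |ρ z| * ‖v‖) := by gcongr
  have hT0 : 0 ≤ ‖v‖ * T := by positivity
  have hR0 : 0 ≤ |ρ z| * ‖v‖ ^ 2 := by positivity
  have hc₁ : 0 ≤ (2 * K₂ * m + 2 * A * K₁ * m) * (‖v‖ * T) := by positivity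
  have hc₂ : 0 ≤ A * (|ρ z| * ‖v‖ ^ 2) := by positivity
  linarith

end Hessian

section Truncation

/-- A smooth convex nondecreasing function which is the identity on `[b, ∞)` and constant
on `(-∞, a]`. -/
lemma exists_convex_truncation {a b : ℝ} (hab : a < b) :
    ∃ χ : ℝ → ℝ, ContDiff ℝ (⊤ : ℕ∞) χ ∧ (∀ s, b ≤ s → χ s = s) ∧ (∀ s, s ≤ b → χ s ≤ b) ∧
      (∀ s, 0 ≤ deriv χ s) ∧ (∀ s, 0 ≤ deriv (deriv χ) s) ∧ ∀ s, s ≤ a → deriv χ s = 0 := by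
  set k : ℝ → ℝ := fun s => Real.smoothTransition ((s - a) / (b - a)) with hk
  have hba : 0 < b - a := sub_pos.2 hab
  have hks : ContDiff ℝ (⊤ : ℕ∞) k := Real.smoothTransition.contDiff.comp (by fun_prop)
  have hkc : Continuous k := hks.continuous
  have hk0 : ∀ s, 0 ≤ k s := fun s => Real.smoothTransition.nonneg _
  have hkm : Monotone k := by
    intro s t hst
    exact Real.smoothTransition.monotone (by gcongr)
  have hk1 : ∀ s, b ≤ s → k s = 1 := fun s hs =>
    Real.smoothTransition.one_of_one_le ((one_le_div hba).2 (by linarith))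
  have hd : ∀ s, HasDerivAt (fun s => b + ∫ x in b..s, k x) (k s) s := fun s =>
    (intervalIntegral.integral_hasDerivAt_right (hkc.intervalIntegrable _ _)
      (hkc.stronglyMeasurableAtFilter _ _) hkc.continuousAt).const_add b
  have hderiv : deriv (fun s => b + ∫ x in b..s, k x) = k := funext fun s => (hd s).deriv
  refine ⟨fun s => b + ∫ x in b..s, k x, ?_, ?_, ?_, ?_, ?_, ?_⟩
  · rw [contDiff_infty_iff_deriv, hderiv]
    exact ⟨fun s => (hd s).differentiableAt, hks⟩
  · intro s hs
    have : ∫ x in b..s, k x = ∫ x in b..s, (1 : ℝ) := by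
      refine intervalIntegral.integral_congr fun x hx => ?_
      rw [uIcc_of_le hs] at hx
      exact hk1 x hx.1
    simp [this]
  · intro s hs
    have : 0 ≤ ∫ x in s..b, k x := intervalIntegral.integral_nonneg hs fun x _ => hk0 x
    simp only [intervalIntegral.integral_symm s b]
    linarith
  · rw [hderiv]; exact hk0
  · rw [hderiv]; exact fun s => hkm.deriv_nonneg
  · rw [hderiv]
    exact fun s hs => Real.smoothTransition.zero_of_nonpos
      (div_nonpos_of_nonpos_of_nonneg (by linarith) hba.le)

/-- A smooth function `F` on the line, equal to the identity near `[0, ∞)`, for which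
`-(-F t) ^ η` is a convex truncation of `-(-t) ^ η`. -/
lemma exists_power_truncation {η c : ℝ} (hη : 0 < η) (hc : 0 < c) :
    ∃ F χ : ℝ → ℝ, ContDiff ℝ (⊤ : ℕ∞) F ∧ ContDiff ℝ (⊤ : ℕ∞) χ ∧
      (∀ t, -(c / 4) ≤ t → F t = t) ∧ (∀ t, t < 0 → F t < 0) ∧
      (∀ t, t < 0 → -((-F t) ^ η) = χ (-((-t) ^ η))) ∧
      (∀ s, 0 ≤ deriv χ s) ∧ (∀ s, 0 ≤ deriv (deriv χ) s) ∧
      ∀ t, t ≤ -c → deriv χ (-((-t) ^ η)) = 0 := by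
  have hb0 : 0 < (c / 2) ^ η := by positivity
  obtain ⟨χ, hχ, hid, hle, h1, h2, h0⟩ := exists_convex_truncation (a := -(c ^ η))
    (b := -((c / 2) ^ η))
    (neg_lt_neg (Real.rpow_lt_rpow (by positivity) (by linarith) hη))
  have hneg : ∀ s, s < 0 → χ s < 0 := by
    intro s hs
    rcases le_total s (-((c / 2) ^ η)) with h | h
    · linarith [hle s h]
    · rwa [hid s h]
  have hs0 : ∀ t : ℝ, t < 0 → -((-t) ^ η) < 0 := fun t ht =>
    neg_lt_zero.2 (Real.rpow_pos_of_pos (neg_pos.2 ht) η)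
  set G : ℝ → ℝ := fun t => -((-χ (-((-t) ^ η))) ^ η⁻¹) with hG
  have hGid : ∀ t, -(c / 2) ≤ t → t ≤ 0 → G t = t := by
    intro t ht ht0
    have h : -((c / 2) ^ η) ≤ -((-t) ^ η) :=
      neg_le_neg (Real.rpow_le_rpow (by linarith) (by linarith) hη.le)
    simp only [hG]
    rw [hid _ h, neg_neg, Real.rpow_rpow_inv (by linarith) hη.ne', neg_neg]
  have hGneg : ∀ t, t < 0 → G t < 0 := fun t ht =>
    neg_lt_zero.2 (Real.rpow_pos_of_pos (neg_pos.2 (hneg _ (hs0 t ht))) _)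
  have hGs : ∀ t, t < 0 → ContDiffAt ℝ (⊤ : ℕ∞) G t := by
    intro t ht
    have h : ContDiffAt ℝ (⊤ : ℕ∞) (fun t : ℝ => -((-t) ^ η)) t :=
      (contDiffAt_id.neg.rpow_const_of_ne (by simpa using ht.ne)).neg
    have h' : ContDiffAt ℝ (⊤ : ℕ∞) (fun t : ℝ => χ (-((-t) ^ η))) t :=
      hχ.contDiffAt.comp t h
    exact (h'.neg.rpow_const_of_ne (neg_ne_zero.2 (hneg _ (hs0 t ht)).ne)).neg
  have hF : ∀ t, t < 0 → (if t < -(c / 4) then G t else t) = G t := by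
    intro t ht
    split_ifs with h
    · rfl
    · exact (hGid t (by linarith) ht.le).symm
  have hFid : ∀ t, -(c / 2) < t → (if t < -(c / 4) then G t else t) = t := by
    intro t ht
    split_ifs with h
    · exact hGid t ht.le (by linarith)
    · rfl
  refine ⟨fun t => if t < -(c / 4) then G t else t, χ, ?_, hχ, ?_, ?_, ?_, h1, h2, ?_⟩
  · rw [contDiff_iff_contDiffAt]
    intro t
    rcases lt_or_ge t 0 with ht | ht
    · exact (hGs t ht).congr_of_eventuallyEq
        ((eventually_lt_nhds ht).mono fun s hs => hF s hs)
    · exact contDiffAt_id.congr_of_eventuallyEq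
        ((eventually_gt_nhds (show -(c / 2) < t by linarith)).mono fun s hs => hFid s hs)
  · intro t ht
    exact hFid t (by linarith)
  · intro t ht
    simp only [hF t ht]
    exact hGneg t ht
  · intro t ht
    simp only [hF t ht]
    simp only [hG, neg_neg]
    rw [Real.rpow_inv_rpow (neg_pos.2 (hneg _ (hs0 t ht))).le hη.ne', neg_neg]
  · intro t ht
    exact h0 _ (neg_le_neg (Real.rpow_le_rpow hc.le (by linarith) hη.le))

end Truncation

section DefiningFunction

variable {n : ℕ}

local notation "E" => EuclideanSpace ℂ (Fin n)

lemma reHess_congr {u w : E → ℝ} {z : E} (h : u =ᶠ[𝓝 z] w) (v : E) :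
    reHess u z v = reHess w z v := by
  simp only [reHess, h.fderiv.fderiv_eq]

/-- The weights of Property (P), extended to the whole space and turned upside down. -/
lemma exists_global_weight {Ω U : Set E} {lam : E → ℝ} {M : ℝ} (hU : IsOpen U)
    (hΩU : closure Ω ⊆ U) (hlam : ContDiffOn ℝ (⊤ : ℕ∞) lam U)
    (h01 : ∀ z ∈ U, 0 ≤ lam z ∧ lam z ≤ 1)
    (hM : ∀ p ∈ frontier Ω, ∀ v : E, 4 * M * ‖v‖ ^ 2 ≤ reHess lam p v) :
    ∃ μ : E → ℝ, ContDiff ℝ (⊤ : ℕ∞) μ ∧ (∀ z, 1 ≤ μ z ∧ μ z ≤ 2) ∧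
      ∀ p ∈ frontier Ω, ∀ v : E, reHess μ p v ≤ -(4 * M * ‖v‖ ^ 2) := by
  obtain ⟨f, hf0, hf1, hf⟩ := exists_contMDiffMap_zero_one_nhds_of_isClosed
    (n := (⊤ : ℕ∞)) (modelWithCornersSelf ℝ E) hU.isClosed_compl (isClosed_closure (s := Ω))
    (disjoint_compl_left_iff_subset.2 hΩU)
  have hfs : ContDiff ℝ (⊤ : ℕ∞) f := f.contMDiff.contDiff
  have hfc : ∀ z ∉ U, f z = 0 := fun z hz => (hf0.self_of_nhdsSet z hz)
  refine ⟨fun z => 2 - f z * lam z, ?_, ?_, ?_⟩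
  · rw [contDiff_iff_contDiffAt]
    intro z
    by_cases hz : z ∈ U
    · exact contDiffAt_const.sub
        (hfs.contDiffAt.mul (hlam.contDiffAt (hU.mem_nhds hz)))
    · refine (contDiffAt_const (c := (2 : ℝ))).congr_of_eventuallyEq ?_
      filter_upwards [eventually_nhdsSet_iff_forall.1 hf0 z hz] with x hx
      simp [hx]
  · intro z
    by_cases hz : z ∈ U
    · have h1 := hf z
      have h2 := h01 z hz
      constructor
      · nlinarith [mul_le_one₀ h1.2 h2.1 h2.2]
      · nlinarith [mul_nonneg h1.1 h2.1]
    · simp [hfc z hz]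
  · intro p hp v
    have hpc : p ∈ closure Ω := frontier_subset_closure hp
    have heq : (fun z => 2 - f z * lam z) =ᶠ[𝓝 p] fun z => 2 - lam z := by
      filter_upwards [eventually_nhdsSet_iff_forall.1 hf1 p hpc] with x hx
      simp [hx]
    have hlp : ContDiffAt ℝ 2 lam p :=
      contDiffAt_infty.1 (hlam.contDiffAt (hU.mem_nhds (hΩU hpc))) 2
    rw [reHess_congr heq, reHess_comp (g := fun t => 2 - t) (g' := fun _ => -1) (g'' := 0) hlp
      (Eventually.of_forall fun t => (hasDerivAt_id t).const_sub 2) (hasDerivAt_const _ _)]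
    linarith [hM p hp v]

/-- The Levi form estimate with a constant uniform along a compact set of regular zeros. -/
lemma exists_reHess_ge_nhdsSet {ρ : E → ℝ} (hρ : ContDiff ℝ (⊤ : ℕ∞) ρ)
    (hpsc : ∀ q, ρ q = 0 → ∀ v : E, fderiv ℝ ρ q v = 0 → fderiv ℝ ρ q (Complex.I • v) = 0 →
      0 ≤ reHess ρ q v) {s : Set E} (hs : IsCompact s) (hs0 : ∀ p ∈ s, ρ p = 0)
    (hds : ∀ p ∈ s, fderiv ℝ ρ p ≠ 0) :
    ∃ C : ℝ, 0 ≤ C ∧ ∀ᶠ z in 𝓝ˢ s, ρ z < 0 → ∀ v : E,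
      -(C * (|ρ z| * ‖v‖ ^ 2 + ‖v‖ * (|fderiv ℝ ρ z v| + |fderiv ℝ ρ z (Complex.I • v)|))) ≤
        reHess ρ z v := by
  refine hs.induction_on ⟨0, le_rfl, by simp⟩ ?_ ?_ ?_
  · rintro s t hst ⟨C, hC, h⟩
    exact ⟨C, hC, h.filter_mono (nhdsSet_mono hst)⟩
  · rintro s t ⟨C, hC, h⟩ ⟨C', hC', h'⟩
    refine ⟨C + C', add_nonneg hC hC', ?_⟩
    rw [nhdsSet_union, eventually_sup]
    constructor
    · filter_upwards [h] with z hz hneg v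
      refine le_trans (neg_le_neg ?_) (hz hneg v)
      gcongr
      linarith
    · filter_upwards [h'] with z hz hneg v
      refine le_trans (neg_le_neg ?_) (hz hneg v)
      gcongr
      linarith
  · intro p hp
    obtain ⟨C, hC⟩ := exists_eventually_reHess_ge hρ hpsc (hs0 p hp) (hds p hp)
    obtain ⟨V, hV, hVo, hpV⟩ := eventually_nhds_iff.1 hC
    refine ⟨V, mem_nhdsWithin_of_mem_nhds (hVo.mem_nhds hpV), |C|, abs_nonneg C, ?_⟩
    filter_upwards [hVo.mem_nhdsSet_self] with z hz hneg v
    refine le_trans (neg_le_neg ?_) (hV z hz hneg v)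
    gcongr
    exact le_abs_self C

lemma mul_sq_add_half_mul_le {ε : ℝ} (hε : 0 < ε) (hε1 : ε < 1) (a b : ℝ) :
    (1 - ε) * (a + ε / 2 * b) ^ 2 ≤ (1 - ε / 2) * a ^ 2 + ε / 2 * b ^ 2 := by
  have h : (1 - ε / 2) * a ^ 2 + ε / 2 * b ^ 2 - (1 - ε) * (a + ε / 2 * b) ^ 2 =
      ε / 2 * ((a - (1 - ε) * b) ^ 2 + ε * (3 / 2 - ε / 2) * b ^ 2) := by ring
  have h' : 0 ≤ ε / 2 * ((a - (1 - ε) * b) ^ 2 + ε * (3 / 2 - ε / 2) * b ^ 2) := by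
    have : 0 < 3 / 2 - ε / 2 := by linarith
    positivity
  linarith

/-- The differential inequality for `log (-ρ) + (ε / 2) log μ` equivalent to plurisubharmonicity
of `-(-ρ μ ^ (ε / 2)) ^ (1 - ε)`. Recall that `Real.log (-t) = Real.log t`. -/
lemma reHess_log_add_le {ρ μ : E → ℝ} {z : E} {ε C M : ℝ} (hρ : ContDiffAt ℝ 2 ρ z)
    (hμ : ContDiffAt ℝ 2 μ z) (hε : 0 < ε) (hε1 : ε < 1)
    (hCM : C + C ^ 2 / ε ≤ ε / 2 * M) (hM : 0 ≤ M)
    (hneg : ρ z < 0) (hμ1 : 1 ≤ μ z) (hμ2 : μ z ≤ 2) {v : E}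
    (hlev : -(C * (|ρ z| * ‖v‖ ^ 2 +
      ‖v‖ * (|fderiv ℝ ρ z v| + |fderiv ℝ ρ z (Complex.I • v)|))) ≤ reHess ρ z v)
    (hHμ : reHess μ z v ≤ -(2 * M * ‖v‖ ^ 2)) :
    reHess (fun x => Real.log (ρ x) + ε / 2 * Real.log (μ x)) z v +
      (1 - ε) * ((fderiv ℝ (fun x => Real.log (ρ x) + ε / 2 * Real.log (μ x)) z v) ^ 2 +
        (fderiv ℝ (fun x => Real.log (ρ x) + ε / 2 * Real.log (μ x)) z (Complex.I • v)) ^ 2)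
      ≤ 0 := by
  have hμ0 : 0 < μ z := by linarith
  have hlog : ∀ {f : E → ℝ}, ContDiffAt ℝ 2 f z → f z ≠ 0 →
      reHess (fun x => Real.log (f x)) z v = reHess f z v / f z -
        ((fderiv ℝ f z v / f z) ^ 2 + (fderiv ℝ f z (Complex.I • v) / f z) ^ 2) := by
    intro f hf hf0
    rw [reHess_comp (g' := fun t => t⁻¹) hf
      ((eventually_ne_nhds hf0).mono fun t ht => Real.hasDerivAt_log ht) (hasDerivAt_inv hf0)]
    field_simp
    ring
  have hD : fderiv ℝ (fun x => Real.log (ρ x) + ε / 2 * Real.log (μ x)) z =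
      (ρ z)⁻¹ • fderiv ℝ ρ z + (ε / 2) • ((μ z)⁻¹ • fderiv ℝ μ z) :=
    (((hρ.differentiableAt (by norm_num)).hasFDerivAt.log hneg.ne).add
      (((hμ.differentiableAt (by norm_num)).hasFDerivAt.log hμ0.ne').const_mul (ε / 2))).fderiv
  rw [reHess_add_const_mul (hρ.log hneg.ne) (hμ.log hμ0.ne'), hlog hρ hneg.ne, hlog hμ hμ0.ne',
    hD]
  have happ : ∀ x : E, ((ρ z)⁻¹ • fderiv ℝ ρ z + (ε / 2) • ((μ z)⁻¹ • fderiv ℝ μ z)) x =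
      fderiv ℝ ρ z x / ρ z + ε / 2 * (fderiv ℝ μ z x / μ z) := by
    intro x
    simp
    ring
  rw [happ, happ]
  have hR : |ρ z| = -ρ z := abs_of_neg hneg
  have hR0 : 0 < -ρ z := by linarith
  set a := fderiv ℝ ρ z v / ρ z with ha
  set b := fderiv ℝ ρ z (Complex.I • v) / ρ z with hb
  have haR : |fderiv ℝ ρ z v| = -ρ z * |a| := by
    rw [ha, abs_div, hR, mul_div_cancel₀ _ hR0.ne']
  have hbR : |fderiv ℝ ρ z (Complex.I • v)| = -ρ z * |b| := by
    rw [hb, abs_div, hR, mul_div_cancel₀ _ hR0.ne']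
  have hHρ : reHess ρ z v / ρ z ≤ C * (‖v‖ ^ 2 + ‖v‖ * (|a| + |b|)) := by
    rw [div_le_iff_of_neg hneg]
    rw [haR, hbR, hR] at hlev
    linarith
  have hHμ' : ε / 2 * (reHess μ z v / μ z) ≤ -(ε / 2 * M * ‖v‖ ^ 2) := by
    have : reHess μ z v / μ z ≤ -(M * ‖v‖ ^ 2) := by
      rw [div_le_iff₀ hμ0]
      nlinarith [mul_nonneg hM (sq_nonneg ‖v‖)]
    nlinarith
  have hyoung : ∀ x : ℝ, C * (‖v‖ * |x|) ≤ ε / 2 * x ^ 2 + C ^ 2 / ε / 2 * ‖v‖ ^ 2 := by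
    intro x
    have h : ε / 2 * x ^ 2 + C ^ 2 / ε / 2 * ‖v‖ ^ 2 - C * (‖v‖ * |x|) =
        (ε * |x| - C * ‖v‖) ^ 2 / (2 * ε) := by
      rw [← sq_abs x]
      field_simp
      ring
    have h' : 0 ≤ (ε * |x| - C * ‖v‖) ^ 2 / (2 * ε) := by positivity
    linarith
  have h1 := mul_sq_add_half_mul_le hε hε1 a (fderiv ℝ μ z v / μ z)
  have h2 := mul_sq_add_half_mul_le hε hε1 b (fderiv ℝ μ z (Complex.I • v) / μ z)
  have h3 := hyoung a
  have h4 := hyoung b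
  have h5 := mul_le_mul_of_nonneg_right hCM (sq_nonneg ‖v‖)
  linarith

/-- A convex increasing function of `-exp (η u)` is plurisubharmonic under the differential
inequality satisfied by `u`. -/
lemma reHess_comp_neg_exp_nonneg {χ : ℝ → ℝ} (hχ : ContDiff ℝ (⊤ : ℕ∞) χ)
    (h1 : ∀ s, 0 ≤ deriv χ s) (h2 : ∀ s, 0 ≤ deriv (deriv χ) s) {η : ℝ} (hη : 0 < η)
    {u : E → ℝ} {z v : E} (hu : ContDiffAt ℝ 2 u z)
    (h : reHess u z v + η * ((fderiv ℝ u z v) ^ 2 + (fderiv ℝ u z (Complex.I • v)) ^ 2) ≤ 0 ∨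
      deriv χ (-Real.exp (η * u z)) = 0) :
    0 ≤ reHess (fun x => χ (-Real.exp (η * u x))) z v := by
  have he : ∀ t, HasDerivAt (fun t => -Real.exp (η * t)) (-(Real.exp (η * t) * η)) t := fun t =>
    ((hasDerivAt_id t).const_mul η).exp.neg.congr_deriv (by simp)
  have hχd : ∀ s, HasDerivAt χ (deriv χ s) s := fun s =>
    (hχ.differentiable (by simp) s).hasDerivAt
  have hχd' : ∀ s, HasDerivAt (deriv χ) (deriv (deriv χ) s) s := fun s =>
    ((contDiff_infty_iff_deriv.1 hχ).2.differentiable (by simp) s).hasDerivAt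
  have hd2 : HasDerivAt (fun t => deriv χ (-Real.exp (η * t)) * (-Real.exp (η * t) * η))
      (deriv (deriv χ) (-Real.exp (η * u z)) * (-(Real.exp (η * u z) * η)) *
        (-Real.exp (η * u z) * η) +
        deriv χ (-Real.exp (η * u z)) * (-(Real.exp (η * u z) * η) * η)) (u z) :=
    ((hχd' _).comp (u z) (he (u z))).mul ((he (u z)).mul_const η)
  rw [reHess_comp (g := fun t => χ (-Real.exp (η * t)))
    (g' := fun t => deriv χ (-Real.exp (η * t)) * (-Real.exp (η * t) * η)) hu
    (Eventually.of_forall fun t => ((hχd _).comp t (he t)).congr_deriv (by ring)) hd2]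
  set e := Real.exp (η * u z)
  have he0 : 0 < e := Real.exp_pos _
  set G := (fderiv ℝ u z v) ^ 2 + (fderiv ℝ u z (Complex.I • v)) ^ 2
  have hG : 0 ≤ G := by positivity
  have hmain : 0 ≤ deriv χ (-e) * (e * η) * -(reHess u z v + η * G) := by
    rcases h with h | h
    · exact mul_nonneg (mul_nonneg (h1 _) (by positivity)) (by linarith)
    · simp [h]
  have hconv : 0 ≤ deriv (deriv χ) (-e) * (e * η) ^ 2 * G :=
    mul_nonneg (mul_nonneg (h2 _) (sq_nonneg _)) hG
  linarith

end DefiningFunction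

theorem diederich_fornaess_index_of_property_P
    (n : ℕ) (hn : 1 ≤ n)
    (Ω : Set (EuclideanSpace ℂ (Fin n)))
    (hΩ_open : IsOpen Ω) (hΩ_bdd : Bornology.IsBounded Ω)
    (ρ : EuclideanSpace ℂ (Fin n) → ℝ)
    (hρ : IsDefiningFunction Ω ρ)
    -- pseudoconvexity
    (hpsc : ∀ p ∈ frontier Ω, ∀ v : EuclideanSpace ℂ (Fin n),
      fderiv ℝ ρ p v = 0 → fderiv ℝ ρ p (Complex.I • v) = 0 → 0 ≤ reHess ρ p v)
    -- Catlin's Property (P)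
    (hP : ∀ M : ℝ, 0 < M → ∃ (U : Set (EuclideanSpace ℂ (Fin n)))
      (lam : EuclideanSpace ℂ (Fin n) → ℝ),
      IsOpen U ∧ closure Ω ⊆ U ∧ ContDiffOn ℝ (⊤ : ℕ∞) lam U ∧
      (∀ z ∈ U, 0 ≤ lam z ∧ lam z ≤ 1) ∧
      (∀ z ∈ U, ∀ v : EuclideanSpace ℂ (Fin n), 0 ≤ reHess lam z v) ∧
      (∀ p ∈ frontier Ω, ∀ v : EuclideanSpace ℂ (Fin n),
        4 * M * ‖v‖ ^ 2 ≤ reHess lam p v)) :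
    ∀ η : ℝ, 0 < η → η < 1 →
      ∃ ρη : EuclideanSpace ℂ (Fin n) → ℝ, IsDefiningFunction Ω ρη ∧
        ∀ z ∈ Ω, ∀ v : EuclideanSpace ℂ (Fin n),
          0 ≤ reHess (fun w => -((-ρη w) ^ η)) z v := by
  intro η hη hη1
  obtain ⟨hρs, hΩρ, hfr, hdρ⟩ := hρ
  have hfc : IsCompact (frontier Ω) :=
    hΩ_bdd.isCompact_closure.of_isClosed_subset isClosed_frontier frontier_subset_closure
  obtain ⟨C, hC, hlev⟩ := exists_reHess_ge_nhdsSet hρs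
    (fun q hq => hpsc q (by rw [hfr]; exact hq)) hfc
    (fun p hp => by rw [hfr] at hp; exact hp) hdρ
  set ε := 1 - η with hε_def
  have hε : 0 < ε := by linarith
  have hε1 : ε < 1 := by linarith
  have hηε : η = 1 - ε := by linarith
  set M := 2 / ε * (C + C ^ 2 / ε) + 1
  have hM : 0 < M := by positivity
  have hCM : C + C ^ 2 / ε ≤ ε / 2 * M := by
    have : ε / 2 * M = C + C ^ 2 / ε + ε / 2 := by
      simp only [M]
      field_simp
    linarith
  obtain ⟨U, lam, hU, hΩU, hlam, h01, -, hlamM⟩ := hP M hM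
  obtain ⟨μ, hμ, hμ12, hHμ⟩ := exists_global_weight hU hΩU hlam h01 hlamM
  have hρ2 : ContDiff ℝ 2 ρ := contDiff_infty.1 hρs 2
  have hμ2 : ContDiff ℝ 2 μ := contDiff_infty.1 hμ 2
  have hμ0 : ∀ z, 0 < μ z := fun z => zero_lt_one.trans_le (hμ12 z).1
  have hHμ' : ∀ᶠ z in 𝓝ˢ (frontier Ω), ∀ v, reHess μ z v ≤ -(2 * M * ‖v‖ ^ 2) :=
    eventually_nhdsSet_iff_forall.2 fun p hp => eventually_reHess_le hμ2 hM (hHμ p hp)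
  obtain ⟨V, hVo, hfV, hV⟩ := eventually_nhdsSet_iff_exists.1 (hlev.and hHμ')
  set m : EuclideanSpace ℂ (Fin n) → ℝ := fun z => Real.exp (ε / 2 * Real.log (μ z)) with hm_def
  have hm0 : ∀ z, 0 < m z := fun z => Real.exp_pos _
  have hm : ContDiff ℝ (⊤ : ℕ∞) m :=
    (contDiff_const.mul (hμ.log fun z => (hμ0 z).ne')).exp
  set r : EuclideanSpace ℂ (Fin n) → ℝ := fun z => ρ z * m z with hr_def
  have hr : ContDiff ℝ (⊤ : ℕ∞) r := hρs.mul hm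
  have hr_neg : ∀ z, r z < 0 ↔ ρ z < 0 := fun z =>
    ⟨fun h => neg_of_mul_neg_left h (hm0 z).le, fun h => mul_neg_of_neg_of_pos h (hm0 z)⟩
  have hr_zero : ∀ z, r z = 0 ↔ ρ z = 0 := fun z => by simp [hr_def, (hm0 z).ne']
  have hΩ_iff : ∀ z, z ∈ Ω ↔ ρ z < 0 := fun z => by rw [hΩρ]; rfl
  obtain ⟨c, hc, hrc⟩ : ∃ c > 0, ∀ z ∈ Ω, z ∉ V → r z ≤ -c := by
    have hK : IsCompact (closure Ω \ V) := hΩ_bdd.isCompact_closure.diff hVo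
    have hKΩ : closure Ω \ V ⊆ Ω := by
      rintro z ⟨hz, hzV⟩
      by_contra hzΩ
      exact hzV (hfV ⟨hz, by rwa [hΩ_open.interior_eq]⟩)
    rcases (closure Ω \ V).eq_empty_or_nonempty with he | hne
    · refine ⟨1, one_pos, fun z hz hzV => ?_⟩
      exact absurd (show z ∈ closure Ω \ V from ⟨subset_closure hz, hzV⟩) (by simp [he])
    · obtain ⟨x, hx, hmax⟩ := hK.exists_isMaxOn hne hr.continuous.continuousOn
      refine ⟨-r x, ?_, fun z hz hzV => ?_⟩
      · linarith [(hr_neg x).2 ((hΩ_iff x).1 (hKΩ hx))]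
      · rw [neg_neg]
        exact hmax ⟨subset_closure hz, hzV⟩
  obtain ⟨F, χ, hF, hχ, hFid, hFneg, hFχ, hχ1, hχ2, hχ0⟩ := exists_power_truncation hη hc
  have hF_neg : ∀ t, F t < 0 ↔ t < 0 := by
    refine fun t => ⟨fun h => ?_, hFneg t⟩
    by_contra! ht
    rw [hFid t (by linarith)] at h
    linarith
  have hF_zero : ∀ t, F t = 0 ↔ t = 0 := by
    intro t
    rcases lt_or_ge t 0 with ht | ht
    · exact iff_of_false (hFneg t ht).ne ht.ne
    · rw [hFid t (by linarith)]
  refine ⟨fun z => F (r z), ⟨hF.comp hr, ?_, ?_, ?_⟩, ?_⟩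
  · ext z
    rw [hΩ_iff, mem_ofPred_eq, hF_neg, hr_neg]
  · rw [hfr]
    ext z
    rw [mem_ofPred_eq, mem_ofPred_eq, hF_zero, hr_zero]
  · intro z hz
    have hz0 : ρ z = 0 := by rwa [hfr] at hz
    have heq : (fun x => F (r x)) =ᶠ[𝓝 z] r := by
      have hlt : -(c / 4) < r z := by rw [(hr_zero z).2 hz0]; linarith
      filter_upwards [continuousAt_const.eventually_lt hr.continuous.continuousAt hlt] with x hx
      exact hFid _ hx.le
    have hd : fderiv ℝ r z = ρ z • fderiv ℝ m z + m z • fderiv ℝ ρ z :=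
      fderiv_mul (hρs.differentiable (by simp) z) (hm.differentiable (by simp) z)
    rw [heq.fderiv_eq, hd, hz0, zero_smul, zero_add]
    exact smul_ne_zero (hm0 z).ne' (hdρ z hz)
  · intro z hz v
    have hρz := (hΩ_iff z).1 hz
    set u : EuclideanSpace ℂ (Fin n) → ℝ := fun x =>
      Real.log (ρ x) + ε / 2 * Real.log (μ x) with hu_def
    have hexp : ∀ x ∈ Ω, (-r x) ^ η = Real.exp (η * u x) := by
      intro x hx
      have hρx := (hΩ_iff x).1 hx
      have h : -r x = Real.exp (u x) := by
        rw [hu_def, Real.exp_add, ← Real.log_neg_eq_log, Real.exp_log (neg_pos.2 hρx), neg_mul]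
      rw [h, ← Real.exp_mul, mul_comm]
    have heq : (fun w => -((-F (r w)) ^ η)) =ᶠ[𝓝 z] fun w => χ (-Real.exp (η * u w)) := by
      filter_upwards [hΩ_open.mem_nhds hz] with w hw
      rw [hFχ _ ((hr_neg w).2 ((hΩ_iff w).1 hw)), hexp w hw]
    rw [reHess_congr heq]
    have hu2 : ContDiffAt ℝ 2 u z :=
      (hρ2.contDiffAt.log hρz.ne).add (contDiffAt_const.mul (hμ2.contDiffAt.log (hμ0 z).ne'))
    refine reHess_comp_neg_exp_nonneg hχ hχ1 hχ2 hη hu2 ?_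
    by_cases hzV : z ∈ V
    · left
      rw [hηε]
      exact reHess_log_add_le hρ2.contDiffAt hμ2.contDiffAt hε hε1 hCM hM.le hρz
        (hμ12 z).1 (hμ12 z).2 ((hV z hzV).1 hρz v) ((hV z hzV).2 v)
    · right
      rw [← hexp z hz]
      exact hχ0 _ (hrc z hz hzV)
end

section
/- Define χ : ℝᴺ → ℝ by χ(x) = ∫_{ℝᴺ} ψ(x − y) · (max_{1≤j≤N} y_j) dy. Then χ is C^∞, for every j the partial derivative satisfies ∂χ/∂x_j (x) = ∫_{{y ∈ ℝᴺ : y_j ≥ y_k for all k}} ψ(x − y) dy ≥ 0, and ∑_{j=1}^N ∂χ/∂x_j (x) = 1 for every x ∈ ℝᴺ. -/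
open Set MeasureTheory

section MaxCoordinate

open Filter Topology

variable {ι : Type*} [Fintype ι]

lemma EuclideanSpace.lipschitzWith_iSup_apply [Nonempty ι] :
    LipschitzWith 1 (fun y : EuclideanSpace ℝ ι => ⨆ j, y j) := by
  refine LipschitzWith.of_le_add fun y z => ciSup_le fun j => ?_
  have hle : z j ≤ ⨆ i, z i := le_ciSup (finite_range fun i => z i).bddAbove j
  have hnorm : ‖(y - z) j‖ ≤ ‖y - z‖ := PiLp.norm_apply_le (y - z) j
  rw [PiLp.sub_apply, Real.norm_eq_abs] at hnorm
  rw [dist_eq_norm]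
  linarith [le_abs_self (y j - z j)]

lemma EuclideanSpace.volume_setOf_apply_eq_apply {j k : ι} (hjk : j ≠ k) :
    volume {y : EuclideanSpace ℝ ι | y j = y k} = 0 := by
  classical
  let S : Submodule ℝ (EuclideanSpace ℝ ι) :=
    LinearMap.ker ((EuclideanSpace.proj j - EuclideanSpace.proj k :
      EuclideanSpace ℝ ι →L[ℝ] ℝ) : EuclideanSpace ℝ ι →ₗ[ℝ] ℝ)
  have hS : S ≠ ⊤ := by
    intro h
    have hmem : EuclideanSpace.single j (1 : ℝ) ∈ S := h ▸ Submodule.mem_top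
    simp [S, hjk.symm] at hmem
  convert Measure.addHaar_submodule volume S hS using 2
  ext y
  simp [S, sub_eq_zero]

lemma EuclideanSpace.measurableSet_setOf_forall_apply_le (j : ι) :
    MeasurableSet {y : EuclideanSpace ℝ ι | ∀ k, y k ≤ y j} := by
  rw [ofPred_forall]
  exact (isClosed_iInter fun k => isClosed_le (by fun_prop) (by fun_prop)).measurableSet

lemma EuclideanSpace.hasDerivAt_iSup_apply_add_smul_single [Nonempty ι] [DecidableEq ι]
    {y : EuclideanSpace ℝ ι} {j : ι} (hy : ∀ k, k ≠ j → y k ≠ y j) :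
    HasDerivAt (fun t : ℝ => ⨆ i, (y + t • EuclideanSpace.single j (1 : ℝ)) i)
      (indicator {y : EuclideanSpace ℝ ι | ∀ k, y k ≤ y j} 1 y) 0 := by
  have hbdd : ∀ z : EuclideanSpace ℝ ι, BddAbove (range fun i => z i) :=
    fun z => (finite_range _).bddAbove
  by_cases hj : ∀ k, y k ≤ y j
  · rw [indicator_of_mem (show y ∈ {y : EuclideanSpace ℝ ι | ∀ k, y k ≤ y j} from hj)]
    have hev : ∀ᶠ t : ℝ in 𝓝 0, ∀ k, k ≠ j → y k < y j + t := by
      rw [eventually_all]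
      intro k
      by_cases hk : k = j
      · simp [hk]
      · have hcont : ContinuousAt (fun t : ℝ => y j + t) 0 := by fun_prop
        filter_upwards [hcont.eventually_const_lt (u := y k)
          (by simpa using lt_of_le_of_ne (hj k) (hy k hk))] with t ht _ using ht
    refine ((hasDerivAt_id (0 : ℝ)).const_add (y j)).congr_of_eventuallyEq ?_
    filter_upwards [hev] with t ht
    refine le_antisymm (ciSup_le fun k => ?_) ?_
    · by_cases hk : k = j
      · simp [hk]
      · simpa [hk] using (ht k hk).le
    · exact le_trans (by simp) (le_ciSup (hbdd _) j)
  · rw [indicator_of_notMem (show y ∉ {y : EuclideanSpace ℝ ι | ∀ k, y k ≤ y j} from hj)]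
    obtain ⟨i, hi⟩ := Finite.exists_max fun i => y i
    push Not at hj
    obtain ⟨k, hk⟩ := hj
    have hij : y j < y i := hk.trans_le (hi k)
    have hne : i ≠ j := by
      rintro rfl
      exact lt_irrefl _ hij
    have hcont : ContinuousAt (fun t : ℝ => y j + t) 0 := by fun_prop
    refine (hasDerivAt_const (0 : ℝ) (y i)).congr_of_eventuallyEq ?_
    filter_upwards [hcont.eventually_lt_const (u := y i) (by simpa using hij)] with t ht
    refine le_antisymm (ciSup_le fun l => ?_) ?_
    · by_cases hl : l = j
      · simpa [hl] using ht.le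
      · simpa [hl] using hi l
    · exact le_trans (by simp [hne]) (le_ciSup (hbdd _) i)

lemma EuclideanSpace.contDiff_integral_mul_iSup_apply [Nonempty ι]
    {ψ : EuclideanSpace ℝ ι → ℝ} {n : ℕ∞} (hψ : ContDiff ℝ n ψ) (hc : HasCompactSupport ψ) :
    ContDiff ℝ n (fun x => ∫ y, ψ (x - y) * ⨆ j, y j) := by
  have hM : LocallyIntegrable (fun y : EuclideanSpace ℝ ι => ⨆ j, y j) volume :=
    lipschitzWith_iSup_apply.continuous.locallyIntegrable
  convert hc.contDiff_convolution_right (ContinuousLinearMap.mul ℝ ℝ) hM hψ using 1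
  ext x
  simp [convolution_def, mul_comm]

lemma EuclideanSpace.hasDerivAt_integral_mul_iSup_apply [Nonempty ι] [DecidableEq ι]
    {ψ : EuclideanSpace ℝ ι → ℝ} (hψ : Continuous ψ) (hc : HasCompactSupport ψ)
    (x : EuclideanSpace ℝ ι) (j : ι) :
    HasDerivAt
      (fun t : ℝ => ∫ y, ψ (x + t • EuclideanSpace.single j (1 : ℝ) - y) * ⨆ i, y i)
      (∫ y in {y : EuclideanSpace ℝ ι | ∀ k, y k ≤ y j}, ψ (x - y)) 0 := by
  set e : EuclideanSpace ℝ ι := EuclideanSpace.single j (1 : ℝ)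
  set A : Set (EuclideanSpace ℝ ι) := {y | ∀ k, y k ≤ y j}
  have hA : MeasurableSet A := measurableSet_setOf_forall_apply_le j
  have hM := (lipschitzWith_iSup_apply (ι := ι)).continuous
  have hF : ∀ t : ℝ, Continuous fun u => ψ u * ⨆ i, (x + t • e - u) i := fun t =>
    hψ.mul (hM.comp (by fun_prop : Continuous fun u => x + t • e - u))
  have hlhs : (fun t : ℝ => ∫ y, ψ (x + t • e - y) * ⨆ i, y i) =
      fun t : ℝ => ∫ u, ψ u * ⨆ i, (x + t • e - u) i := by
    ext t
    rw [← integral_sub_left_eq_self _ volume (x + t • e)]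
    simp only [sub_sub_cancel]
  have hrhs : ∫ y in A, ψ (x - y) = ∫ u, ψ u * indicator A 1 (x - u) := by
    rw [← integral_indicator hA, ← integral_sub_left_eq_self _ volume x]
    congr 1 with u
    by_cases hu : x - u ∈ A <;> simp [hu]
  rw [hlhs, hrhs]
  refine (hasDerivAt_integral_of_dominated_loc_of_lip (bound := ψ) univ_mem
    (Eventually.of_forall fun t => (hF t).aestronglyMeasurable)
    ((hF 0).integrable_of_hasCompactSupport hc.mul_right) ?_ ?_
    (hψ.integrable_of_hasCompactSupport hc) ?_).2
  · refine hψ.aestronglyMeasurable.mul (Measurable.aestronglyMeasurable ?_)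
    exact (measurable_one.indicator hA).comp (by fun_prop)
  · refine Eventually.of_forall fun u => LipschitzWith.lipschitzOnWith ?_
    refine LipschitzWith.of_dist_le_mul fun s t => ?_
    have hlip := lipschitzWith_iSup_apply.dist_le_mul (x + s • e - u) (x + t • e - u)
    have hdist : dist (x + s • e - u) (x + t • e - u) = dist s t := by
      rw [dist_sub_right, dist_add_left, dist_eq_norm, ← sub_smul, norm_smul]
      simp [e, dist_eq_norm]
    rw [hdist, NNReal.coe_one, one_mul] at hlip
    rw [Real.dist_eq, ← mul_sub, abs_mul, Real.coe_nnabs]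
    gcongr
    exact hlip
  · have hae : ∀ᵐ y : EuclideanSpace ℝ ι, ∀ k, k ≠ j → y k ≠ y j := by
      rw [ae_all_iff]
      intro k
      by_cases hk : k = j
      · simp [hk]
      · have h0 : ∀ᵐ y : EuclideanSpace ℝ ι, y k ≠ y j := by
          rw [ae_iff]
          simpa using volume_setOf_apply_eq_apply hk
        filter_upwards [h0] with y h _ using h
    filter_upwards [(quasiMeasurePreserving_sub_left volume x).ae hae] with u hu
    have hd := (hasDerivAt_iSup_apply_add_smul_single hu).const_mul (ψ u)
    simpa only [e, sub_add_eq_add_sub] using hd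

lemma EuclideanSpace.sum_setIntegral_setOf_forall_apply_le [Nonempty ι]
    {f : EuclideanSpace ℝ ι → ℝ} (hf : Integrable f) :
    ∑ j, ∫ y in {y : EuclideanSpace ℝ ι | ∀ k, y k ≤ y j}, f y = ∫ y, f y := by
  have hunion : ⋃ j, {y : EuclideanSpace ℝ ι | ∀ k, y k ≤ y j} = univ := by
    refine eq_univ_of_forall fun y => mem_iUnion.2 ?_
    exact Finite.exists_max fun i => y i
  have h := integral_iUnion_ae (μ := volume) (f := f)
    (s := fun j => {y : EuclideanSpace ℝ ι | ∀ k, y k ≤ y j})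
    (fun j => (measurableSet_setOf_forall_apply_le j).nullMeasurableSet)
    (fun j k hjk => measure_mono_null (fun y hy => le_antisymm (hy.2 j) (hy.1 k))
      (volume_setOf_apply_eq_apply hjk)) hf.integrableOn
  rw [hunion, setIntegral_univ, tsum_fintype] at h
  exact h.symm

end MaxCoordinate

theorem mollified_max_derivatives
    (N : ℕ) (hN : 0 < N)
    (ψ : EuclideanSpace ℝ (Fin N) → ℝ)
    (hψ_smooth : ContDiff ℝ (⊤ : ℕ∞) ψ)
    (hψ_nonneg : ∀ u, 0 ≤ ψ u)
    (hψ_supp : tsupport ψ ⊆ Metric.closedBall 0 1)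
    (hψ_int : ∫ u, ψ u = 1)
    (χ : EuclideanSpace ℝ (Fin N) → ℝ)
    (hχ : ∀ x, χ x = ∫ y, ψ (x - y) * (⨆ j, y j)) :
    ContDiff ℝ (⊤ : ℕ∞) χ ∧
    (∀ x, ∀ j : Fin N,
      fderiv ℝ χ x (EuclideanSpace.single j 1)
        = ∫ y in {y : EuclideanSpace ℝ (Fin N) | ∀ k, y k ≤ y j}, ψ (x - y) ∧
      0 ≤ fderiv ℝ χ x (EuclideanSpace.single j 1)) ∧
    (∀ x, ∑ j : Fin N, fderiv ℝ χ x (EuclideanSpace.single j 1) = 1) := by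
  have : Nonempty (Fin N) := ⟨⟨0, hN⟩⟩
  have hc : HasCompactSupport ψ :=
    (isCompact_closedBall 0 1).of_isClosed_subset (isClosed_tsupport ψ) hψ_supp
  obtain rfl : χ = fun x => ∫ y, ψ (x - y) * (⨆ j, y j) := funext hχ
  have hsmooth := EuclideanSpace.contDiff_integral_mul_iSup_apply hψ_smooth hc
  have hderiv : ∀ x, ∀ j : Fin N,
      fderiv ℝ (fun x => ∫ y, ψ (x - y) * (⨆ j, y j)) x (EuclideanSpace.single j 1)
        = ∫ y in {y : EuclideanSpace ℝ (Fin N) | ∀ k, y k ≤ y j}, ψ (x - y) := by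
    intro x j
    have hdiff := (hsmooth.differentiable (by simp)) x
    rw [← hdiff.lineDeriv_eq_fderiv]
    exact (EuclideanSpace.hasDerivAt_integral_mul_iSup_apply hψ_smooth.continuous hc x j).deriv
  refine ⟨hsmooth, fun x j => ⟨hderiv x j, ?_⟩, fun x => ?_⟩
  · rw [hderiv]
    exact integral_nonneg fun y => hψ_nonneg _
  · have hint : Integrable fun y => ψ (x - y) :=
      (hψ_smooth.continuous.integrable_of_hasCompactSupport hc).comp_sub_left x
    simp_rw [hderiv, EuclideanSpace.sum_setIntegral_setOf_forall_apply_le hint,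
      integral_sub_left_eq_self ψ volume x, hψ_int]
end

section
/- Let m be a nonnegative integer and let g : ℝ → ℂ be (m+1)-times continuously differentiable. Define F : ℝ² → ℂ by F(x, y) = ∑_{j=0}^{m} x^j · ((−i)^j / j!) · g^{(j)}(y), where g^{(j)} denotes the j-th derivative of g. Then for all (x, y) ∈ ℝ², (1/2)·(∂F/∂x (x,y) + i·∂F/∂y (x,y)) = −(1/2)·x^m · ((−i)^{m+1}/m!) · g^{(m+1)}(y). (The left-hand side is the Wirtinger derivative ∂F/∂z̄ of F under the identification z = x + iy.) -/
/-- The `x`-derivative of the Taylor-type sum with coefficients `c`. -/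
theorem hasDerivAt_sum_pow_div_factorial (m : ℕ) (c : ℕ → ℂ) (x : ℝ) :
    HasDerivAt (fun t : ℝ => ∑ j ∈ Finset.range (m + 1),
        (t : ℂ) ^ j * ((-Complex.I) ^ j / (j.factorial : ℂ)) * c j)
      (∑ j ∈ Finset.range m,
        (x : ℂ) ^ j * ((-Complex.I) ^ (j + 1) / (j.factorial : ℂ)) * c (j + 1)) x := by
  have hsum : HasDerivAt (fun t : ℝ => ∑ j ∈ Finset.range (m + 1),
        (t : ℂ) ^ j * ((-Complex.I) ^ j / (j.factorial : ℂ)) * c j)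
      (∑ j ∈ Finset.range (m + 1),
        ((j : ℂ) * (x : ℂ) ^ (j - 1)) * ((-Complex.I) ^ j / (j.factorial : ℂ)) * c j) x := by
    refine HasDerivAt.fun_sum fun j _ => ?_
    exact (((hasDerivAt_pow j (x : ℂ)).comp_ofReal).mul_const _).mul_const _
  convert hsum using 1
  rw [Finset.sum_range_succ']
  simp only [Nat.cast_zero, zero_mul, add_zero, Nat.add_sub_cancel]
  refine Finset.sum_congr rfl fun j _ => ?_
  have hj : (j.factorial : ℂ) ≠ 0 := by exact_mod_cast j.factorial_ne_zero
  have hj' : (j : ℂ) + 1 ≠ 0 := by exact_mod_cast j.succ_ne_zero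
  rw [Nat.factorial_succ]
  push_cast
  field_simp

/-- A linear combination of derivatives of order less than `n` of a `C^n` function is
differentiated termwise. -/
theorem ContDiff.hasDerivAt_sum_mul_iteratedDeriv {n : ℕ} {g : ℝ → ℂ} (hg : ContDiff ℝ n g)
    (a : ℕ → ℂ) (y : ℝ) :
    HasDerivAt (fun t : ℝ => ∑ j ∈ Finset.range n, a j * iteratedDeriv j g t)
      (∑ j ∈ Finset.range n, a j * iteratedDeriv (j + 1) g y) y := by
  refine HasDerivAt.fun_sum fun j hj => ?_
  rw [iteratedDeriv_succ]
  have hdiff : Differentiable ℝ (iteratedDeriv j g) :=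
    hg.differentiable_iteratedDeriv j (by exact_mod_cast Finset.mem_range.mp hj)
  exact (hdiff y).hasDerivAt.const_mul _

theorem wirtinger_derivative_of_taylor_sum (m : ℕ) (g : ℝ → ℂ)
    (hg : ContDiff ℝ (m + 1 : ℕ) g)
    (F : ℝ → ℝ → ℂ)
    (hF : ∀ x y : ℝ, F x y = ∑ j ∈ Finset.range (m + 1),
      (x : ℂ) ^ j * ((-Complex.I) ^ j / (j.factorial : ℂ)) * iteratedDeriv j g y) :
    ∀ x y : ℝ,
      (1 / 2 : ℂ) * (deriv (fun t => F t y) x + Complex.I * deriv (fun t => F x t) y)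
        = -(1 / 2 : ℂ) * (x : ℂ) ^ m * ((-Complex.I) ^ (m + 1) / (m.factorial : ℂ))
          * iteratedDeriv (m + 1) g y := by
  intro x y
  simp only [hF]
  rw [(hasDerivAt_sum_pow_div_factorial m (fun j => iteratedDeriv j g y) x).deriv,
    (hg.hasDerivAt_sum_mul_iteratedDeriv
      (fun j => (x : ℂ) ^ j * ((-Complex.I) ^ j / (j.factorial : ℂ))) y).deriv]
  have hI : Complex.I * ∑ j ∈ Finset.range (m + 1),
        (x : ℂ) ^ j * ((-Complex.I) ^ j / (j.factorial : ℂ)) * iteratedDeriv (j + 1) g y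
      = -∑ j ∈ Finset.range (m + 1),
        (x : ℂ) ^ j * ((-Complex.I) ^ (j + 1) / (j.factorial : ℂ))
          * iteratedDeriv (j + 1) g y := by
    rw [Finset.mul_sum, ← Finset.sum_neg_distrib]
    refine Finset.sum_congr rfl fun j _ => ?_
    rw [pow_succ (-Complex.I)]
    ring
  rw [hI, Finset.sum_range_succ]
  ring
end

section
/- Let r > 0 and c > 0, and let λ : ℝ² → ℝ be a C² function on the open ball B(0, r) satisfying 0 ≤ λ ≤ 1 on B(0, r) and Δλ ≥ c on B(0, r), where Δλ = ∂²λ/∂x² + ∂²λ/∂y² is the Laplacian. Then c·r² ≤ 4. -/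
open Metric

/-- At a local maximum the second derivative of a continuous function is nonpositive. -/
theorem IsLocalMax.deriv_deriv_nonpos {g : ℝ → ℝ} {t : ℝ} (h : IsLocalMax g t)
    (hg : ContinuousAt g t) : deriv (deriv g) t ≤ 0 := by
  by_contra! hpos
  have hmin : IsLocalMin g t := isLocalMin_of_deriv_deriv_pos hpos h.deriv_eq_zero hg
  have heq : g =ᶠ[nhds t] fun _ => g t := by
    filter_upwards [h, hmin] with s h₁ h₂ using le_antisymm h₁ h₂
  rw [heq.deriv.deriv_eq] at hpos
  simp at hpos

/-- If `f - k ‖·‖²` has a local maximum at `x`, then the Hessian of `f` at `x` is bounded above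
by `2 k`. -/
theorem IsLocalMax.fderiv_fderiv_le {E : Type*} [NormedAddCommGroup E] [InnerProductSpace ℝ E]
    {f : E → ℝ} {x : E} {k : ℝ} (h : IsLocalMax (fun y => f y - k * ‖y‖ ^ 2) x)
    (hf : ContDiffAt ℝ 2 f x) (v : E) :
    fderiv ℝ (fderiv ℝ f) x v v ≤ 2 * k * ‖v‖ ^ 2 := by
  have hline : ∀ t : ℝ, HasDerivAt (fun t : ℝ => x + t • v) v t := fun t => by
    simpa using ((hasDerivAt_id t).smul_const v).const_add x
  have htend : Filter.Tendsto (fun t : ℝ => x + t • v) (nhds 0) (nhds x) := by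
    simpa using (hline 0).continuousAt.tendsto
  have hdiff : ∀ᶠ y in nhds x, DifferentiableAt ℝ f y :=
    (hf.eventually (by simp)).mono fun y hy => hy.differentiableAt (by simp)
  have hnorm : ∀ t : ℝ, HasDerivAt (fun t : ℝ => k * ‖x + t • v‖ ^ 2)
      (k * (2 * inner ℝ (x + t • v) v)) t := fun t => ((hline t).norm_sq).const_mul k
  have hderiv : ∀ᶠ t in nhds (0 : ℝ),
      HasDerivAt (fun t : ℝ => f (x + t • v) - k * ‖x + t • v‖ ^ 2)
        (fderiv ℝ f (x + t • v) v - k * (2 * inner ℝ (x + t • v) v)) t := by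
    filter_upwards [htend.eventually hdiff] with t ht
    exact (ht.hasFDerivAt.comp_hasDerivAt t (hline t)).sub (hnorm t)
  have hmax : IsLocalMax (fun t : ℝ => f (x + t • v) - k * ‖x + t • v‖ ^ 2) 0 := by
    filter_upwards [htend.eventually h] with t ht
    simpa using ht
  have hnonpos := hmax.deriv_deriv_nonpos hderiv.self_of_nhds.continuousAt
  have hsecond : HasDerivAt
      (fun t : ℝ => fderiv ℝ f (x + t • v) v - k * (2 * inner ℝ (x + t • v) v))
      (fderiv ℝ (fderiv ℝ f) x v v - k * (2 * inner ℝ v v)) 0 := by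
    have hd : HasFDerivAt (fderiv ℝ f) (fderiv ℝ (fderiv ℝ f) x) (x + (0 : ℝ) • v) := by
      have : ContDiffAt ℝ 1 (fderiv ℝ f) x := hf.fderiv_right (by norm_num)
      simpa using (this.differentiableAt (by simp)).hasFDerivAt
    have hgrad : HasDerivAt (fun t : ℝ => fderiv ℝ f (x + t • v))
        (fderiv ℝ (fderiv ℝ f) x v) 0 := hd.comp_hasDerivAt (0 : ℝ) (hline 0)
    have h₁ : HasDerivAt (fun t : ℝ => fderiv ℝ f (x + t • v) v)
        (fderiv ℝ (fderiv ℝ f) x v v) 0 := by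
      simpa using hgrad.clm_apply (hasDerivAt_const (0 : ℝ) v)
    have h₂ := (hline 0).inner ℝ (hasDerivAt_const (0 : ℝ) v)
    rw [inner_zero_right, zero_add] at h₂
    exact h₁.sub ((h₂.const_mul 2).const_mul k)
  have heq : deriv (fun t : ℝ => f (x + t • v) - k * ‖x + t • v‖ ^ 2) =ᶠ[nhds 0]
      fun t : ℝ => fderiv ℝ f (x + t • v) v - k * (2 * inner ℝ (x + t • v) v) :=
    hderiv.mono fun t ht => ht.deriv
  rw [heq.deriv_eq, hsecond.deriv, real_inner_self_eq_norm_sq] at hnonpos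
  linarith

theorem laplacian_growth_bound (r c : ℝ) (hr : 0 < r) (hc : 0 < c)
    (lam : EuclideanSpace ℝ (Fin 2) → ℝ)
    (hlam_smooth : ContDiffOn ℝ 2 lam (ball 0 r))
    (hlam_bounds : ∀ z ∈ ball (0 : EuclideanSpace ℝ (Fin 2)) r, 0 ≤ lam z ∧ lam z ≤ 1)
    (hlap : ∀ z ∈ ball (0 : EuclideanSpace ℝ (Fin 2)) r,
      c ≤ ∑ i : Fin 2,
        fderiv ℝ (fderiv ℝ lam) z (EuclideanSpace.single i 1) (EuclideanSpace.single i 1)) :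
    c * r ^ 2 ≤ 4 := by
  by_contra! hcon
  obtain ⟨k, hk₁, hk₂⟩ : ∃ k, 1 / r ^ 2 < k ∧ k < c / 4 :=
    exists_between (by rw [div_lt_div_iff₀ (by positivity) (by norm_num)]; linarith)
  have hk : 0 < k := lt_trans (by positivity) hk₁
  have hsqrt : √(1 / k) < r := by
    rw [Real.sqrt_lt' hr]
    rw [div_lt_iff₀ (by positivity)] at hk₁ ⊢
    linarith
  obtain ⟨s, hs₁, hsr⟩ := exists_between hsqrt
  have hs : 0 < s := (Real.sqrt_nonneg _).trans_lt hs₁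
  have hks : 1 < k * s ^ 2 := by
    rw [Real.sqrt_lt' hs, div_lt_iff₀ hk] at hs₁
    linarith
  have hsub : closedBall (0 : EuclideanSpace ℝ (Fin 2)) s ⊆ ball 0 r :=
    closedBall_subset_ball hsr
  have hcont : ContinuousOn (fun y => lam y - k * ‖y‖ ^ 2)
      (closedBall (0 : EuclideanSpace ℝ (Fin 2)) s) :=
    (hlam_smooth.continuousOn.mono hsub).sub (by fun_prop)
  obtain ⟨z, hz, hzmax⟩ := (isCompact_closedBall _ _).exists_isMaxOn
    ⟨0, mem_closedBall_self hs.le⟩ hcont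
  have hz_int : z ∈ ball (0 : EuclideanSpace ℝ (Fin 2)) s := by
    by_contra hout
    have hzs : s ≤ ‖z‖ := by simpa using hout
    have h₀ : lam 0 - k * ‖(0 : EuclideanSpace ℝ (Fin 2))‖ ^ 2 ≤ lam z - k * ‖z‖ ^ 2 :=
      hzmax (mem_closedBall_self hs.le)
    have hlam₀ := (hlam_bounds 0 (mem_ball_self hr)).1
    have hlamz := (hlam_bounds z (hsub hz)).2
    have hle : k * s ^ 2 ≤ k * ‖z‖ ^ 2 := by gcongr
    simp only [norm_zero] at h₀
    linarith
  have hloc : IsLocalMax (fun y => lam y - k * ‖y‖ ^ 2) z :=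
    hzmax.isLocalMax (Filter.mem_of_superset (isOpen_ball.mem_nhds hz_int) ball_subset_closedBall)
  have hsmooth : ContDiffAt ℝ 2 lam z := hlam_smooth.contDiffAt (isOpen_ball.mem_nhds (hsub hz))
  have hsum := hlap z (hsub hz)
  have hHess := fun i : Fin 2 => hloc.fderiv_fderiv_le hsmooth (EuclideanSpace.single i 1)
  rw [Fin.sum_univ_two] at hsum
  have h₀ := hHess 0
  have h₁ := hHess 1
  simp only [PiLp.norm_single, norm_one] at h₀ h₁
  linarith
end
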